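/- Let T be a linear involution without connection on the alphabet A, and let S = L(T) be its natural coding. For every nonempty word w ∈ S, the set CR_S(w) of complete first return words to {w, w⁻¹} has exactly 2·Card(A) elements. -/

import Mathlib

open Set

namespace LinInv

/-- A letter of the extended alphabet `A ∪ A⁻¹`, encoded as a pair of a letter
of `A` and a sign. -/
abbrev Letter (A : Type*) := A × Bool

/-- The formal inverse of a letter. -/
def Letter.inv {A : Type*} (c : Letter A) : Letter A := (c.1, !c.2)

/-- The inverse of a word over `A ∪ A⁻¹`. -/
def wordInv {A : Type*} (u : List (Letter A)) : List (Letter A) :=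
  (u.map Letter.inv).reverse

/-- The involution `σ₂` exchanging the two components of `Î = I × {0,1}`. -/
def s2 (z : ℝ × Bool) : ℝ × Bool := (z.1, !z.2)

/-- A linear involution on the alphabet `A`: the open interval `I = ]lo,hi[`,
for each `c ∈ A ∪ A⁻¹` an open subinterval `I_c = ]endLo c, endHi c[ × {comp c}`
of one of the two components of `Î = I × {0,1}`, the finite set `Sig` of division
points, and the first involution `σ₁`, subject to the defining conditions. -/
structure LinearInvolution (A : Type*) [Fintype A] where
  lo : ℝ
  hi : ℝ
  lo_lt_hi : lo < hi
  endLo : Letter A → ℝ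
  endHi : Letter A → ℝ
  end_lt : ∀ c, endLo c < endHi c
  comp : Letter A → Bool
  sub_lo : ∀ c, lo ≤ endLo c
  sub_hi : ∀ c, endHi c ≤ hi
  /-- the length data satisfy `λ_a = λ_{a⁻¹}` -/
  len_inv : ∀ c, endHi c - endLo c = endHi (Letter.inv c) - endLo (Letter.inv c)
  /-- the set of division points -/
  Sig : Set (ℝ × Bool)
  Sig_sub : Sig ⊆ Ioo lo hi ×ˢ (univ : Set Bool)
  /-- there are `2k-2` division points -/
  Sig_card : Sig.ncard = 2 * Fintype.card A - 2
  /-- the intervals `I_c` are pairwise disjoint -/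
  disj : ∀ c d : Letter A, c ≠ d →
    Disjoint (Ioo (endLo c) (endHi c) ×ˢ ({comp c} : Set Bool))
      (Ioo (endLo d) (endHi d) ×ˢ ({comp d} : Set Bool))
  Sig_disj : ∀ c : Letter A,
    Disjoint Sig (Ioo (endLo c) (endHi c) ×ˢ ({comp c} : Set Bool))
  /-- the intervals `I_c` partition `Î` minus the division points -/
  cover : Ioo lo hi ×ˢ (univ : Set Bool) =
    (⋃ c : Letter A, Ioo (endLo c) (endHi c) ×ˢ ({comp c} : Set Bool)) ∪ Sig
  /-- the first involution `σ₁` (as a total map; only its values on `Î ∖ Σ` matter) -/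
  s1 : ℝ × Bool → ℝ × Bool
  s1_invol : ∀ z ∈ (Ioo lo hi ×ˢ (univ : Set Bool)) \ Sig, s1 (s1 z) = z
  /-- on each `I_c`, `σ₁` is either a translation or a symmetry -/
  s1_iso : ∀ c : Letter A,
    (∃ α : ℝ, ∀ z ∈ Ioo (endLo c) (endHi c) ×ˢ ({comp c} : Set Bool),
        s1 z = (z.1 + α, comp (Letter.inv c))) ∨
    (∃ α : ℝ, ∀ z ∈ Ioo (endLo c) (endHi c) ×ˢ ({comp c} : Set Bool),
        s1 z = (-z.1 + α, comp (Letter.inv c)))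
  /-- `σ₁` maps `I_c` onto `I_{c⁻¹}` -/
  s1_image : ∀ c : Letter A,
    s1 '' (Ioo (endLo c) (endHi c) ×ˢ ({comp c} : Set Bool)) =
      Ioo (endLo (Letter.inv c)) (endHi (Letter.inv c)) ×ˢ
        ({comp (Letter.inv c)} : Set Bool)

namespace LinearInvolution

variable {A : Type*} [Fintype A] (L : LinearInvolution A)

/-- The domain `Î = I × {0,1}`. -/
def Ihat : Set (ℝ × Bool) := Ioo L.lo L.hi ×ˢ (univ : Set Bool)

/-- The interval `I_c` associated with the letter `c ∈ A ∪ A⁻¹`. -/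
def Ia (c : Letter A) : Set (ℝ × Bool) :=
  Ioo (L.endLo c) (L.endHi c) ×ˢ ({L.comp c} : Set Bool)

/-- The linear involution `T = σ₂ ∘ σ₁`. -/
def T (z : ℝ × Bool) : ℝ × Bool := s2 (L.s1 z)

/-- `O = ⋃_{n ≥ 0} T⁻ⁿ(Σ)`, the negative orbit of the singular points. -/
def O : Set (ℝ × Bool) := ⋃ n : ℕ, (L.T)^[n] ⁻¹' L.Sig

/-- `Ô = O ∪ σ₂(O)`. -/
def Ohat : Set (ℝ × Bool) := L.O ∪ s2 '' L.O

/-- `T` has a connection if some singularity `x` of `T⁻¹` reaches a singularity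
`y` of `T` in `n ≥ 0` steps. -/
def HasConnection : Prop := ∃ x ∈ s2 '' L.Sig, ∃ n : ℕ, (L.T)^[n] x ∈ L.Sig

/-- `T` is nonorientable if some `I_c` and `I_{c⁻¹}` lie in the same component. -/
def Nonorientable : Prop := ∃ c : Letter A, L.comp c = L.comp (Letter.inv c)

/-- `T` is orientable if it is not nonorientable. -/
def Orientable : Prop := ¬ L.Nonorientable

/-- `u` occurs in the natural coding of the orbit of `z` at position `m`. -/
def IsCodingFrom (z : ℝ × Bool) (m : ℕ) (u : List (Letter A)) : Prop :=
  ∀ i : Fin u.length, (L.T)^[m + i.1] z ∈ L.Ia (u.get i)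

/-- The natural coding `L(T)`: the set of factors of the infinite natural
codings `Σ_T(z)` for `z ∈ Î ∖ Ô`. -/
def lang : Set (List (Letter A)) :=
  {u | ∃ z ∈ L.Ihat \ L.Ohat, ∃ m : ℕ, L.IsCodingFrom z m u}

/-- The interval `I_w = I_{a₀} ∩ T⁻¹(I_{a₁}) ∩ ⋯ ∩ T^{-m+1}(I_{a_{m-1}})`
associated with a word `w = a₀a₁⋯a_{m-1}`; by convention `I_ε = Î`. -/
def Iw (u : List (Letter A)) : Set (ℝ × Bool) :=
  L.Ihat ∩ ⋂ i : Fin u.length, (L.T)^[i.1] ⁻¹' L.Ia (u.get i)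

/-- The return time `ρ_X(x) = inf {n ≥ 1 ∣ Tⁿ(x) ∈ X}`, with value `∞` if the
orbit of `x` never returns to `X`. -/
noncomputable def retTime (X : Set (ℝ × Bool)) (x : ℝ × Bool) : ℕ∞ :=
  sInf {n : ℕ∞ | ∃ m : ℕ, n = (m : ℕ∞) ∧ 1 ≤ m ∧ (L.T)^[m] x ∈ X}

/-- A word is even if it has an even number of odd letters (a letter `a` is odd
when `I_a` and `I_{a⁻¹}` lie in the same component). -/
def EvenWord (u : List (Letter A)) : Prop :=
  Even (u.countP fun c => L.comp (c.1, true) == L.comp (c.1, false))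

/-- The morphism `F_A → ℤ/2ℤ` sending each odd letter to `1` and each even
letter to `0`. -/
noncomputable def evenHom : FreeGroup A →* Multiplicative (ZMod 2) :=
  FreeGroup.lift fun a =>
    Multiplicative.ofAdd (if L.comp (a, true) = L.comp (a, false) then (1 : ZMod 2) else 0)

/-- The even group: the subgroup of `F_A` formed by the even elements. -/
noncomputable def evenGroup : Subgroup (FreeGroup A) := (L.evenHom).ker

/-- The admissibility condition at an endpoint `x` of an interval `J`:
either `x = Tⁿ(z)` for a singularity `z` of `T⁻¹` with `T^k(z) ∉ J` for
`0 ≤ k ≤ n`, or `Tⁿ(x) = z` for a singularity `z` of `T` with `T^k(x) ∉ J`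
for `0 ≤ k ≤ n`. -/
def AdmissibleEndpoint (J : Set (ℝ × Bool)) (x : ℝ × Bool) : Prop :=
  (∃ z ∈ s2 '' L.Sig, ∃ n : ℕ, (L.T)^[n] z = x ∧ ∀ k ≤ n, (L.T)^[k] z ∉ J) ∨
  (∃ z ∈ L.Sig, ∃ n : ℕ, (L.T)^[n] x = z ∧ ∀ k ≤ n, (L.T)^[k] x ∉ J)

/-- The open interval `]u,v[ × {δ}` is admissible with respect to `T`. -/
def AdmissibleInterval (u v : ℝ) (δ : Bool) : Prop :=
  u < v ∧ L.AdmissibleEndpoint (Ioo u v ×ˢ ({δ} : Set Bool)) (u, δ) ∧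
    L.AdmissibleEndpoint (Ioo u v ×ˢ ({δ} : Set Bool)) (v, δ)

end LinearInvolution

/-- A set of words is factorial if it contains the factors of its elements. -/
def FactorialSet {α : Type*} (S : Set (List α)) : Prop :=
  ∀ u ∈ S, ∀ v : List α, v <:+: u → v ∈ S

/-- A word over `A ∪ A⁻¹` is reduced if it has no factor `c c⁻¹`. -/
def Reduced {A : Type*} (u : List (Letter A)) : Prop :=
  u.Chain' fun c d => d ≠ Letter.inv c

/-- A laminary set on `A`: a symmetric factorial set of reduced words on
`A ∪ A⁻¹`. -/
def Laminary {A : Type*} (S : Set (List (Letter A))) : Prop :=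
  FactorialSet S ∧ (∀ u ∈ S, wordInv u ∈ S) ∧ ∀ u ∈ S, Reduced u

/-- A laminary set is orientable if it splits as `S₊ ∪ S₋` with `S₊, S₋`
factorial, `S₊ ∩ S₋ = {ε}`, and `x ∈ S₋ ↔ x⁻¹ ∈ S₊`. -/
def OrientableSet {A : Type*} (S : Set (List (Letter A))) : Prop :=
  ∃ Sp Sm : Set (List (Letter A)), FactorialSet Sp ∧ FactorialSet Sm ∧
    S = Sp ∪ Sm ∧ Sp ∩ Sm = {([] : List (Letter A))} ∧
    ∀ x ∈ S, (x ∈ Sm ↔ wordInv x ∈ Sp)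

/-- A set of words is uniformly recurrent if it is right extendable and every
`u ∈ S` occurs in every long enough word of `S`. -/
def UniformlyRecurrent {α : Type*} (S : Set (List α)) : Prop :=
  (∀ u ∈ S, ∃ c : α, u ++ [c] ∈ S) ∧
  ∀ u ∈ S, ∃ n : ℕ, 1 ≤ n ∧ ∀ w ∈ S, w.length = n → u <:+: w

/-- A set of words over `A ∪ A⁻¹` is uniformly semi-recurrent if it is right
extendable and for every `u ∈ S`, every long enough word of `S` contains `u` or
`u⁻¹` as a factor. -/
def UniformlySemiRecurrent {A : Type*} (S : Set (List (Letter A))) : Prop :=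
  (∀ u ∈ S, ∃ c : Letter A, u ++ [c] ∈ S) ∧
  ∀ u ∈ S, ∃ n : ℕ, 1 ≤ n ∧ ∀ w ∈ S, w.length = n → (u <:+: w ∨ wordInv u <:+: w)

/-- A laminary set is semi-recurrent if for all `u, w ∈ S` there is `v ∈ S`
with `uvw ∈ S` or `uvw⁻¹ ∈ S`. -/
def SemiRecurrent {A : Type*} (S : Set (List (Letter A))) : Prop :=
  ∀ u ∈ S, ∀ w ∈ S, ∃ v ∈ S, u ++ v ++ w ∈ S ∨ u ++ v ++ wordInv w ∈ S

/-- A complete return word to `X ⊆ S`: a word of `S` with a proper prefix in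
`X` and a proper suffix in `X`. -/
def CompleteReturnWord {α : Type*} (S X : Set (List α)) (u : List α) : Prop :=
  u ∈ S ∧ (∃ p ∈ X, p <+: u ∧ p ≠ u) ∧ (∃ s ∈ X, s <:+ u ∧ s ≠ u)

/-- A complete first return word to `X`: a complete return word to `X` with no
internal factor in `X`. -/
def CompleteFirstReturnWord {α : Type*} (S X : Set (List α)) (u : List α) : Prop :=
  CompleteReturnWord S X u ∧
    ¬ ∃ p v s : List α, u = p ++ v ++ s ∧ v ∈ X ∧ p ≠ [] ∧ s ≠ []

/-- `CR S w`: the set of complete first return words to `{w, w⁻¹}` in `S`. -/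
def CR {A : Type*} (S : Set (List (Letter A))) (w : List (Letter A)) :
    Set (List (Letter A)) :=
  {u | CompleteFirstReturnWord S {w, wordInv w} u}

open Classical in
/-- The operation `N` on complete return words to `{w, w⁻¹}`: erase the prefix
`w` if present, and erase the suffix `w⁻¹` if present. -/
noncomputable def NN {A : Type*} (w u : List (Letter A)) : List (Letter A) :=
  let u' := if w <+: u then u.drop w.length else u
  if wordInv w <:+ u' then u'.take (u'.length - w.length) else u'

/-- `MR S w`: the set of mixed first return words to `w` in `S`. -/
noncomputable def MR {A : Type*} (S : Set (List (Letter A))) (w : List (Letter A)) :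
    Set (List (Letter A)) :=
  NN w '' CR S w

/-- `RightReturn S w`: the set of first right return words to `w` in `S`,
i.e. the words `u` such that `wu` is a complete first return word to `{w}`. -/
def RightReturn {α : Type*} (S : Set (List α)) (w : List α) : Set (List α) :=
  {u | CompleteFirstReturnWord S {w} (w ++ u)}

/-- `X` is a basis (free generating set) of the subgroup `H`: the canonical map
`FreeGroup X → G` is injective with range `H`. -/
def IsBasisOf {G : Type*} [Group G] (X : Set G) (H : Subgroup G) : Prop :=
  Function.Injective (FreeGroup.lift (fun x : X => (x : G))) ∧
    (FreeGroup.lift (fun x : X => (x : G)) : FreeGroup X →* G).range = H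

/-- `Y` is a symmetric basis of `H` if `Y = X ∪ X⁻¹` for some basis `X` of `H`. -/
def IsSymmetricBasisOf {G : Type*} [Group G] (Y : Set G) (H : Subgroup G) : Prop :=
  ∃ X : Set G, IsBasisOf X H ∧ Y = X ∪ X⁻¹

/-- The prime words in `S` with respect to a subgroup `G` of `F_A`: the
nonempty words of `G ∩ S` without a proper nonempty prefix in `G ∩ S`. -/
def PrimeWords {A : Type*} (S : Set (List (Letter A))) (G : Subgroup (FreeGroup A)) :
    Set (List (Letter A)) :=
  {u | u ∈ S ∧ u ≠ [] ∧ FreeGroup.mk u ∈ G ∧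
    ∀ p : List (Letter A), p <+: u → p ≠ [] → p ≠ u → ¬(p ∈ S ∧ FreeGroup.mk p ∈ G)}

section Words

variable {A : Type*}

theorem Letter.inv_inv (c : Letter A) : Letter.inv (Letter.inv c) = c := by
  simp [Letter.inv]

theorem Letter.inv_ne (c : Letter A) : Letter.inv c ≠ c := by
  intro h
  have := congrArg Prod.snd h
  simp [Letter.inv] at this

theorem wordInv_cons (c : Letter A) (v : List (Letter A)) :
    wordInv (c :: v) = wordInv v ++ [Letter.inv c] := by
  simp [wordInv]

theorem wordInv_append (u v : List (Letter A)) :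
    wordInv (u ++ v) = wordInv v ++ wordInv u := by
  simp [wordInv]

theorem wordInv_wordInv (u : List (Letter A)) : wordInv (wordInv u) = u := by
  have h : (Letter.inv ∘ Letter.inv : Letter A → Letter A) = id :=
    funext Letter.inv_inv
  simp [wordInv, h]

theorem wordInv_length (u : List (Letter A)) : (wordInv u).length = u.length := by
  simp [wordInv]

theorem s2_s2 (z : ℝ × Bool) : s2 (s2 z) = z := by
  simp [s2]

/-- A nonempty reduced word differs from its inverse. -/
theorem Reduced.ne_wordInv {w : List (Letter A)} (hr : Reduced w) (hne : w ≠ []) :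
    w ≠ wordInv w := by
  intro h
  have hlen : 0 < w.length := List.length_pos_iff.mpr hne
  have key : ∀ i (hi : i < w.length),
      w[i] = Letter.inv (w[w.length - 1 - i]'(by omega)) := by
    intro i hi
    have h1 : w[i]? = (wordInv w)[i]? := by rw [← h]
    have hi' : i < (wordInv w).length := by rw [wordInv_length]; exact hi
    rw [List.getElem?_eq_getElem hi, List.getElem?_eq_getElem hi'] at h1
    have h2 := Option.some.inj h1
    rw [h2]
    simp [wordInv]
  have hr' := List.isChain_iff_getElem.mp hr
  rcases Nat.even_or_odd' w.length with ⟨m, hm | hm⟩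
  · have h1 := hr' (m - 1) (by omega)
    have h2 := key (m - 1 + 1) (by omega)
    have e : w.length - 1 - (m - 1 + 1) = m - 1 := by omega
    simp only [e] at h2
    exact h1 h2
  · have h2 := key m (by omega)
    have e : w.length - 1 - m = m := by omega
    simp only [e] at h2
    exact Letter.inv_ne _ h2.symm

theorem exists_infix_wordInv {X : Set (List (Letter A))} (hXinv : ∀ x ∈ X, wordInv x ∈ X)
    {u : List (Letter A)}     (hx : ∃ x ∈ X, x <:+: u) : ∃ x ∈ X, x <:+: wordInv u := by
  obtain ⟨x, hx, p, s, rfl⟩ := hx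
  exact ⟨wordInv x, hXinv x hx, wordInv s, wordInv p, by simp [wordInv_append]⟩

end Words

section FirstOccurrence

variable {α : Type*}

/-- The words having a suffix in `X` and no other occurrence of a word of `X`. -/
def FirstOcc (X : Set (List α)) : Set (List α) :=
  {v | (∃ x ∈ X, x <:+ v) ∧ ∀ p x s, v = p ++ x ++ s → x ∈ X → s = []}

/-- A word with a factor in `X` has a prefix in `FirstOcc X`. -/
theorem exists_prefix_firstOcc {X : Set (List α)} (v : List α)
    (h : ∃ x ∈ X, x <:+: v) : ∃ p ∈ FirstOcc X, p <+: v := by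
  induction v using List.reverseRecOn with
  | nil =>
    obtain ⟨x, hx, hxv⟩ := h
    refine ⟨[], ⟨⟨x, hx, ?_⟩, ?_⟩, List.prefix_rfl⟩
    · rw [List.eq_nil_of_infix_nil hxv]
    · intro p x s h _
      simp at h
      exact h.2.2
  | append_singleton v d ih =>
    by_cases hv : ∃ x ∈ X, x <:+: v
    · obtain ⟨p, hp, hpv⟩ := ih hv
      exact ⟨p, hp, hpv.trans (List.prefix_append _ _)⟩
    · have key : ∀ p x s, v ++ [d] = p ++ x ++ s → x ∈ X → s = [] := by
        intro p x s h hx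
        by_contra hs
        obtain ⟨s', e, rfl⟩ := (List.eq_nil_or_concat' s).resolve_left hs
        rw [← List.append_assoc] at h
        have := List.append_inj_left' h rfl
        exact hv ⟨x, hx, p, s', this.symm⟩
      refine ⟨v ++ [d], ⟨?_, key⟩, List.prefix_rfl⟩
      obtain ⟨x, hx, p, s, hps⟩ := h
      have := key p x s hps.symm hx
      subst this
      exact ⟨x, hx, p, by simpa using hps⟩

/-- Two comparable words of `FirstOcc X` are equal. -/
theorem FirstOcc.eq_of_prefix {X : Set (List α)} {u v : List α} (hu : u ∈ FirstOcc X)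
    (hv : v ∈ FirstOcc X) (h : u <+: v) : u = v := by
  obtain ⟨s, rfl⟩ := h
  obtain ⟨x, hx, p, rfl⟩ := hu.1
  rw [hv.2 p x s rfl hx, List.append_nil]

theorem FirstOcc.ne_nil {X : Set (List α)} {v : List α} (hX : [] ∉ X)
    (hv : v ∈ FirstOcc X) : v ≠ [] := by
  rintro rfl
  obtain ⟨x, hx, hxv⟩ := hv.1
  rw [List.suffix_nil.mp hxv] at hx
  exact hX hx

variable {S X : Set (List α)} {n : ℕ}

theorem FirstOcc.le_length (hX : ∀ x ∈ X, x.length = n) {v : List α}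
    (hv : v ∈ FirstOcc X) : n ≤ v.length := by
  obtain ⟨x, hx, hxv⟩ := hv.1
  exact hX x hx ▸ hxv.length_le

/-- The left extensions in `S` of the elements of `FirstOcc X` split into elements of
`FirstOcc X` and complete first return words to `X`. -/
theorem firstOcc_or_completeFirstReturn {c : α} {v : List α} (hX : ∀ x ∈ X, x.length = n)
    (hlen : n ≤ v.length) (hS : c :: v ∈ S) :
    (c :: v ∈ FirstOcc X ∨ CompleteFirstReturnWord S X (c :: v)) ↔ v ∈ FirstOcc X := by
  have suff : ∀ x ∈ X, x <:+ c :: v → x <:+ v := by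
    intro x hx h
    rcases List.suffix_cons_iff.mp h with h | h
    · have := hX x hx
      rw [h] at this
      simp at this
      omega
    · exact h
  constructor
  · rintro (h | h)
    · obtain ⟨⟨x, hx, hxs⟩, h2⟩ := h
      refine ⟨⟨x, hx, suff x hx hxs⟩, fun p x s hv hx => h2 (c :: p) x s (by simp [hv]) hx⟩
    · obtain ⟨⟨_, _, x, hx, hxs, _⟩, h2⟩ := h
      refine ⟨⟨x, hx, suff x hx hxs⟩, fun p x s hv hx => ?_⟩
      by_contra hs
      exact h2 ⟨c :: p, x, s, by simp [hv], hx, by simp, hs⟩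
  · rintro ⟨⟨x, hx, hxs⟩, h2⟩
    have inner : ∀ p x s, c :: v = p ++ x ++ s → x ∈ X → p ≠ [] → s = [] := by
      intro p x s h hx hp
      obtain ⟨d, p', rfl⟩ := List.exists_cons_of_ne_nil hp
      simp only [List.cons_append, List.cons.injEq] at h
      exact h2 p' x s h.2 hx
    by_cases hc : ∃ y ∈ X, y <+: c :: v
    · right
      obtain ⟨y, hy, hyp⟩ := hc
      refine ⟨⟨hS, ⟨y, hy, hyp, ?_⟩, ⟨x, hx, hxs.trans (List.suffix_cons _ _), ?_⟩⟩, ?_⟩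
      · rintro rfl
        have := hX _ hy
        simp at this
        omega
      · rintro rfl
        have := hX _ hx
        simp at this
        omega
      · rintro ⟨p, y, s, h, hy, hp, hs⟩
        exact hs (inner p y s h hy hp)
    · left
      refine ⟨⟨x, hx, hxs.trans (List.suffix_cons _ _)⟩, fun p y s h hy => ?_⟩
      by_cases hp : p = []
      · subst hp
        exact absurd ⟨y, hy, s, by simpa using h.symm⟩ hc
      · exact inner p y s h hy hp

theorem not_completeFirstReturn_of_firstOcc {u : List α} (hu : u ∈ FirstOcc X) :
    ¬ CompleteFirstReturnWord S X u := by
  rintro ⟨⟨_, ⟨p, hp, ⟨s, hs⟩, hne⟩, _⟩, _⟩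
  have := hu.2 [] p s (by simpa using hs.symm) hp
  subst this
  exact hne (by simpa using hs)

theorem CompleteFirstReturnWord.length_lt {u : List α} (hX : ∀ x ∈ X, x.length = n)
    (hu : CompleteFirstReturnWord S X u) : n < u.length := by
  obtain ⟨⟨_, ⟨p, hp, hpre, hne⟩, _⟩, _⟩ := hu
  rw [← hX p hp]
  exact lt_of_le_of_ne hpre.length_le fun h => hne (hpre.eq_of_length h)

/-- The words of `FirstOcc X` of the length of the elements of `X` are those elements. -/
theorem mem_firstOcc_of_length_eq {u : List α} (hX : ∀ x ∈ X, x.length = n)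
    (hu : u.length = n) : u ∈ FirstOcc X ↔ u ∈ X := by
  constructor
  · rintro ⟨⟨x, hx, hxu⟩, _⟩
    rwa [← hxu.eq_of_length (by rw [hX x hx, hu])]
  · intro h
    refine ⟨⟨u, h, List.suffix_rfl⟩, fun p x s hu' hx => ?_⟩
    have h1 := congrArg List.length hu'
    simp only [List.length_append, hX x hx, hu] at h1
    exact List.length_eq_zero_iff.mp (by omega)

end FirstOccurrence

namespace LinearInvolution

variable {A : Type*} [Fintype A] (L : LinearInvolution A)

section Basic

variable {L}

theorem mem_Ihat {z : ℝ × Bool} : z ∈ L.Ihat ↔ z.1 ∈ Ioo L.lo L.hi := by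
  simp [Ihat]

theorem mem_Ia {c : Letter A} {z : ℝ × Bool} :
    z ∈ L.Ia c ↔ z.1 ∈ Ioo (L.endLo c) (L.endHi c) ∧ z.2 = L.comp c := by
  simp [Ia]

theorem s2_mem_Ihat {z : ℝ × Bool} : s2 z ∈ L.Ihat ↔ z ∈ L.Ihat := by
  simp [mem_Ihat, s2]

theorem Ia_subset_Ihat (c : Letter A) : L.Ia c ⊆ L.Ihat := by
  intro z hz
  rw [mem_Ia] at hz
  exact mem_Ihat.mpr ⟨(L.sub_lo c).trans_lt hz.1.1, hz.1.2.trans_le (L.sub_hi c)⟩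

theorem not_mem_Sig {c : Letter A} {z : ℝ × Bool} (hz : z ∈ L.Ia c) : z ∉ L.Sig :=
  fun h => Set.disjoint_left.mp (L.Sig_disj c) h hz

theorem exists_mem_Ia {z : ℝ × Bool} (hz : z ∈ L.Ihat) (hs : z ∉ L.Sig) :
    ∃ c, z ∈ L.Ia c := by
  have h : z ∈ (⋃ c : Letter A, L.Ia c) ∪ L.Sig := L.cover ▸ hz
  exact mem_iUnion.mp (h.resolve_right hs)

theorem Ia_unique {c d : Letter A} {z : ℝ × Bool} (hc : z ∈ L.Ia c) (hd : z ∈ L.Ia d) :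
    c = d := by
  by_contra h
  exact Set.disjoint_left.mp (L.disj c d h) hc hd

theorem s1_mem_Ia {c : Letter A} {z : ℝ × Bool} (hz : z ∈ L.Ia c) :
    L.s1 z ∈ L.Ia (Letter.inv c) :=
  (L.s1_image c).subset (mem_image_of_mem _ hz)

theorem s1_s1 {c : Letter A} {z : ℝ × Bool} (hz : z ∈ L.Ia c) : L.s1 (L.s1 z) = z :=
  L.s1_invol z ⟨Ia_subset_Ihat c hz, not_mem_Sig hz⟩

theorem s2_T (z : ℝ × Bool) : s2 (L.T z) = L.s1 z := s2_s2 _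

theorem T_mem_Ihat {c : Letter A} {z : ℝ × Bool} (hz : z ∈ L.Ia c) : L.T z ∈ L.Ihat :=
  s2_mem_Ihat.mpr (Ia_subset_Ihat _ (s1_mem_Ia hz))

theorem T_s1 {c : Letter A} {z : ℝ × Bool} (hz : z ∈ L.Ia c) : L.T (L.s1 z) = s2 z := by
  rw [T, s1_s1 hz]

theorem T_injOn (c : Letter A) : InjOn L.T (L.Ia c) := by
  intro y hy z hz h
  have := congrArg s2 h
  rw [s2_T, s2_T] at this
  rw [← s1_s1 hy, ← s1_s1 hz, this]

/-- Reducedness: after visiting `I_c` the orbit does not enter `I_{c⁻¹}`. -/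
theorem T_not_mem {c : Letter A} {z : ℝ × Bool} (hz : z ∈ L.Ia c) :
    L.T z ∉ L.Ia (Letter.inv c) := by
  intro h
  have h1 := (mem_Ia.mp h).2
  have h2 := (mem_Ia.mp (s1_mem_Ia hz)).2
  rw [← h2] at h1
  simp [T, s2] at h1

end Basic

/-- The set of points whose orbit is coded by the word `u` on its first steps. -/
def cyl : List (Letter A) → Set (ℝ × Bool)
  | [] => L.Ihat
  | c :: u => L.Ia c ∩ L.T ⁻¹' cyl u

section Cylinders

variable {L}

theorem mem_cyl_cons {c : Letter A} {u : List (Letter A)} {z : ℝ × Bool} :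
    z ∈ L.cyl (c :: u) ↔ z ∈ L.Ia c ∧ L.T z ∈ L.cyl u := Iff.rfl

theorem cyl_singleton (c : Letter A) : L.cyl [c] = L.Ia c := by
  ext z
  rw [mem_cyl_cons]
  exact ⟨fun h => h.1, fun h => ⟨h, T_mem_Ihat h⟩⟩

theorem cyl_subset_Ihat (u : List (Letter A)) : L.cyl u ⊆ L.Ihat := by
  cases u with
  | nil => exact subset_rfl
  | cons c u => exact fun z hz => Ia_subset_Ihat c hz.1

theorem mem_cyl_append {u v : List (Letter A)} {z : ℝ × Bool} :
    z ∈ L.cyl (u ++ v) ↔ z ∈ L.cyl u ∧ (L.T)^[u.length] z ∈ L.cyl v := by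
  induction u generalizing z with
  | nil => exact ⟨fun h => ⟨cyl_subset_Ihat v h, h⟩, fun h => h.2⟩
  | cons c u ih =>
    rw [List.cons_append, mem_cyl_cons, ih, mem_cyl_cons, and_assoc, List.length_cons,
      Function.iterate_succ_apply]

theorem isCodingFrom_zero_cons {c : Letter A} {u : List (Letter A)} {z : ℝ × Bool} :
    L.IsCodingFrom z 0 (c :: u) ↔ z ∈ L.Ia c ∧ L.IsCodingFrom (L.T z) 0 u := by
  simp only [IsCodingFrom, List.length_cons, Fin.forall_fin_succ, zero_add]
  simp

theorem mem_cyl_iff {u : List (Letter A)} {z : ℝ × Bool} :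
    z ∈ L.cyl u ↔ z ∈ L.Ihat ∧ L.IsCodingFrom z 0 u := by
  induction u generalizing z with
  | nil => simp [cyl, IsCodingFrom]
  | cons c u ih =>
    rw [mem_cyl_cons, isCodingFrom_zero_cons, ih]
    exact ⟨fun h => ⟨Ia_subset_Ihat c h.1, h.1, h.2.2⟩, fun h => ⟨h.2.1, T_mem_Ihat h.2.1, h.2.2⟩⟩

theorem isCodingFrom_iterate {u : List (Letter A)} {z : ℝ × Bool} {m : ℕ} :
    L.IsCodingFrom z m u ↔ L.IsCodingFrom ((L.T)^[m] z) 0 u := by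
  simp only [IsCodingFrom, zero_add]
  refine forall_congr' fun i => ?_
  rw [add_comm, Function.iterate_add_apply]

theorem iterate_mem_Ihat {z : ℝ × Bool} {m : ℕ} (hz : z ∈ L.Ihat)
    (h : ∀ j < m, (L.T)^[j] z ∉ L.Sig) : (L.T)^[m] z ∈ L.Ihat := by
  induction m with
  | zero => exact hz
  | succ m ih =>
    obtain ⟨c, hc⟩ := exists_mem_Ia (ih fun j hj => h j (by omega)) (h m (by omega))
    rw [Function.iterate_succ_apply']
    exact T_mem_Ihat hc

theorem exists_coding {z : ℝ × Bool} {m : ℕ} (hz : z ∈ L.Ihat)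
    (h : ∀ j < m, (L.T)^[j] z ∉ L.Sig) : ∃ v, v.length = m ∧ z ∈ L.cyl v := by
  induction m generalizing z with
  | zero => exact ⟨[], rfl, hz⟩
  | succ m ih =>
    obtain ⟨c, hc⟩ := exists_mem_Ia hz (h 0 (by omega))
    obtain ⟨v, hv, hzv⟩ := ih (T_mem_Ihat hc) fun j hj => h (j + 1) (by omega)
    exact ⟨c :: v, by simp [hv], hc, hzv⟩

theorem prefix_of_mem_cyl {u v : List (Letter A)} {z : ℝ × Bool} (hu : z ∈ L.cyl u)
    (hv : z ∈ L.cyl v) (h : u.length ≤ v.length) : u <+: v := by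
  induction u generalizing v z with
  | nil => exact List.nil_prefix
  | cons c u ih =>
    cases v with
    | nil => simp at h
    | cons d v =>
      rw [Ia_unique hu.1 hv.1]
      exact List.cons_prefix_cons.mpr ⟨rfl, ih hu.2 hv.2 (by simpa using h)⟩

theorem eq_of_mem_cyl {u v : List (Letter A)} {z : ℝ × Bool} (hu : z ∈ L.cyl u)
    (hv : z ∈ L.cyl v) (h : u.length = v.length) : u = v :=
  (prefix_of_mem_cyl hu hv h.le).eq_of_length h

theorem reduced_of_mem_cyl {u : List (Letter A)} {z : ℝ × Bool} (hz : z ∈ L.cyl u) :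
    Reduced u := by
  induction u generalizing z with
  | nil => exact List.isChain_nil
  | cons c u ih =>
    cases u with
    | nil => exact List.isChain_singleton _
    | cons d u =>
      refine List.isChain_cons_cons.mpr ⟨?_, ih hz.2⟩
      rintro rfl
      exact T_not_mem hz.1 hz.2.1

/-- Concatenating the inverse of the coding of `s2 z` and the coding of `z`. -/
theorem cyl_wordInv_append_nonempty {q v : List (Letter A)} {z : ℝ × Bool}
    (hq : s2 z ∈ L.cyl q) (hv : z ∈ L.cyl v) : (L.cyl (wordInv q ++ v)).Nonempty := by
  induction q generalizing v z with
  | nil => exact ⟨z, hv⟩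
  | cons c q ih =>
    rw [wordInv_cons, List.append_assoc, List.singleton_append]
    refine ih (z := L.s1 (s2 z)) ?_ ⟨s1_mem_Ia hq.1, ?_⟩
    · exact hq.2
    · rw [mem_preimage, T_s1 hq.1, s2_s2]
      exact hv

theorem cyl_wordInv_nonempty {q : List (Letter A)} (h : (L.cyl q).Nonempty) :
    (L.cyl (wordInv q)).Nonempty := by
  obtain ⟨z, hz⟩ := h
  have := cyl_wordInv_append_nonempty (q := q) (v := []) (z := s2 z) (by rwa [s2_s2])
    (s2_mem_Ihat.mpr (cyl_subset_Ihat q hz))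
  simpa using this

theorem cyl_nonempty_of_infix {u v : List (Letter A)} (h : u <:+: v)
    (hv : (L.cyl v).Nonempty) : (L.cyl u).Nonempty := by
  obtain ⟨p, s, rfl⟩ := h
  obtain ⟨z, hz⟩ := hv
  rw [mem_cyl_append, mem_cyl_append] at hz
  exact ⟨_, hz.1.2⟩

/-- On `I_c`, the map `T` is a translation or a symmetry onto `σ₂(I_{c⁻¹})`. -/
theorem T_affine (c : Letter A) :
    (∃ α : ℝ, ∀ z ∈ L.Ia c, L.T z = (z.1 + α, !L.comp (Letter.inv c))) ∨
    (∃ α : ℝ, ∀ z ∈ L.Ia c, L.T z = (-z.1 + α, !L.comp (Letter.inv c))) := by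
  rcases L.s1_iso c with ⟨α, h⟩ | ⟨α, h⟩
  · exact Or.inl ⟨α, fun z hz => by rw [T, h z hz]; rfl⟩
  · exact Or.inr ⟨α, fun z hz => by rw [T, h z hz]; rfl⟩

/-- The cylinder of a nonempty word is an open interval in one component. -/
theorem cyl_eq_prod {u : List (Letter A)} (hu : u ≠ []) :
    ∃ (C : Set ℝ) (δ : Bool), IsOpen C ∧ C.OrdConnected ∧ L.cyl u = C ×ˢ {δ} := by
  induction u with
  | nil => exact absurd rfl hu
  | cons c u ih =>
    by_cases hu' : u = []
    · subst hu'
      exact ⟨Ioo (L.endLo c) (L.endHi c), L.comp c, isOpen_Ioo, ordConnected_Ioo,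
        cyl_singleton c⟩
    obtain ⟨C, δ, hC, hCc, hCu⟩ := ih hu'
    by_cases hδ : (!L.comp (Letter.inv c)) = δ
    · rcases T_affine (L := L) c with ⟨α, h⟩ | ⟨α, h⟩
      · refine ⟨Ioo (L.endLo c) (L.endHi c) ∩ (fun t => t + α) ⁻¹' C, L.comp c,
          isOpen_Ioo.inter (hC.preimage (by fun_prop)),
          ordConnected_Ioo.inter (hCc.preimage_mono fun a b h => by simpa using h), ?_⟩
        ext z
        rw [mem_cyl_cons, hCu]
        constructor
        · rintro ⟨hz, hT⟩
          rw [h z hz] at hT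
          rw [mem_Ia] at hz
          exact ⟨⟨hz.1, hT.1⟩, hz.2⟩
        · rintro ⟨⟨h1, h2⟩, h3⟩
          have hz : z ∈ L.Ia c := mem_Ia.mpr ⟨h1, h3⟩
          refine ⟨hz, ?_⟩
          rw [h z hz]
          exact ⟨h2, hδ⟩
      · refine ⟨Ioo (L.endLo c) (L.endHi c) ∩ (fun t => -t + α) ⁻¹' C, L.comp c,
          isOpen_Ioo.inter (hC.preimage (by fun_prop)),
          ordConnected_Ioo.inter (hCc.preimage_anti fun a b h => by linarith), ?_⟩
        ext z
        rw [mem_cyl_cons, hCu]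
        constructor
        · rintro ⟨hz, hT⟩
          rw [h z hz] at hT
          rw [mem_Ia] at hz
          exact ⟨⟨hz.1, hT.1⟩, hz.2⟩
        · rintro ⟨⟨h1, h2⟩, h3⟩
          have hz : z ∈ L.Ia c := mem_Ia.mpr ⟨h1, h3⟩
          refine ⟨hz, ?_⟩
          rw [h z hz]
          exact ⟨h2, hδ⟩
    · refine ⟨∅, true, isOpen_empty, ordConnected_empty, ?_⟩
      rw [empty_prod, eq_empty_iff_forall_notMem]
      rintro z ⟨hz, hT⟩
      rw [mem_preimage, hCu] at hT
      apply hδ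
      rcases T_affine (L := L) c with ⟨α, h⟩ | ⟨α, h⟩
      · rw [h z hz] at hT
        exact hT.2
      · rw [h z hz] at hT
        exact hT.2

theorem isOpen_Ihat : IsOpen L.Ihat := isOpen_Ioo.prod isOpen_univ

theorem isOpen_cyl (u : List (Letter A)) : IsOpen (L.cyl u) := by
  by_cases hu : u = []
  · subst hu
    exact isOpen_Ihat
  · obtain ⟨C, δ, hC, -, h⟩ := cyl_eq_prod (L := L) hu
    rw [h]
    exact hC.prod (isOpen_discrete _)

end Cylinders

section Language

variable {L}

theorem countable_preimage_Sig (hfin : L.Sig.Finite) (m : ℕ) :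
    {z | z ∈ L.Ihat ∧ (L.T)^[m] z ∈ L.Sig}.Countable := by
  induction m with
  | zero => exact hfin.countable.mono fun z hz => hz.2
  | succ m ih =>
    refine (hfin.countable.union (countable_iUnion fun c => ?_)).mono ?_
      (s₂ := L.Sig ∪ ⋃ c, {z | z ∈ L.Ia c ∧ (L.T)^[m + 1] z ∈ L.Sig})
    · refine MapsTo.countable_of_injOn (f := L.T) ?_ ((T_injOn c).mono fun z hz => hz.1) ih
      intro z hz
      exact ⟨T_mem_Ihat hz.1, hz.2⟩
    · intro z hz
      by_cases hs : z ∈ L.Sig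
      · exact Or.inl hs
      · obtain ⟨c, hc⟩ := exists_mem_Ia hz.1 hs
        exact Or.inr (mem_iUnion.mpr ⟨c, hc, hz.2⟩)

theorem countable_Ihat_inter_O (hfin : L.Sig.Finite) : (L.Ihat ∩ L.O).Countable := by
  refine (countable_iUnion (countable_preimage_Sig hfin)).mono ?_
  rintro z ⟨hz, hO⟩
  obtain ⟨m, hm⟩ := mem_iUnion.mp hO
  exact mem_iUnion.mpr ⟨m, hz, hm⟩

theorem countable_Ihat_inter_Ohat (hfin : L.Sig.Finite) :
    (L.Ihat ∩ L.Ohat).Countable := by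
  refine ((countable_Ihat_inter_O hfin).union
    ((countable_Ihat_inter_O hfin).image s2)).mono ?_
  rintro z ⟨hz, h | ⟨y, hy, rfl⟩⟩
  · exact Or.inl ⟨hz, h⟩
  · exact Or.inr ⟨y, ⟨s2_mem_Ihat.mp hz, hy⟩, rfl⟩

theorem exists_mem_diff_Ohat (hfin : L.Sig.Finite) {U : Set (ℝ × Bool)} (hU : IsOpen U)
    (hne : U.Nonempty) (hUI : U ⊆ L.Ihat) : ∃ z ∈ U, z ∈ L.Ihat \ L.Ohat := by
  obtain ⟨⟨t, δ⟩, ht⟩ := hne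
  have hcount : {t : ℝ | (t, δ) ∈ L.Ihat ∩ L.Ohat}.Countable :=
    (countable_Ihat_inter_Ohat hfin).preimage (Prod.mk_left_injective δ)
  have hopen : IsOpen {t : ℝ | (t, δ) ∈ U} := hU.preimage (by fun_prop)
  obtain ⟨s, hs, hsU⟩ := (hcount.dense_compl ℝ).exists_mem_open hopen ⟨t, ht⟩
  exact ⟨(s, δ), hsU, hUI hsU, fun h => hs ⟨hUI hsU, h⟩⟩

theorem mem_lang_iff (hfin : L.Sig.Finite) {u : List (Letter A)} :
    u ∈ L.lang ↔ (L.cyl u).Nonempty := by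
  constructor
  · rintro ⟨z, ⟨hz, hO⟩, m, h⟩
    refine ⟨(L.T)^[m] z, mem_cyl_iff.mpr ⟨iterate_mem_Ihat hz fun j _ hj => ?_,
      isCodingFrom_iterate.mp h⟩⟩
    exact hO (Or.inl (mem_iUnion.mpr ⟨j, hj⟩))
  · intro h
    obtain ⟨z, hz, hz'⟩ := exists_mem_diff_Ohat hfin (isOpen_cyl u) h (cyl_subset_Ihat u)
    exact ⟨z, hz', 0, (mem_cyl_iff.mp hz).2⟩

/-- Every word of the language is a prefix of a word of the language of any larger length. -/
theorem exists_prefix_mem_lang (hfin : L.Sig.Finite) {u : List (Letter A)}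
    (hu : u ∈ L.lang) {m : ℕ} (hm : u.length ≤ m) :
    ∃ v ∈ L.lang, v.length = m ∧ u <+: v := by
  obtain ⟨z, hz, hzI, hO⟩ := exists_mem_diff_Ohat hfin (isOpen_cyl u)
    ((mem_lang_iff hfin).mp hu) (cyl_subset_Ihat u)
  obtain ⟨v, hv, hzv⟩ := exists_coding (m := m) hzI fun j _ hj =>
    hO (Or.inl (mem_iUnion.mpr ⟨j, hj⟩))
  exact ⟨v, (mem_lang_iff hfin).mpr ⟨z, hzv⟩, hv, prefix_of_mem_cyl hz hzv (hv ▸ hm)⟩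

end Language

section NoConnection

variable {L}

theorem iterate_s2_not_mem_Sig (hnc : ¬ L.HasConnection) {y : ℝ × Bool} (hy : y ∈ L.Sig)
    (m : ℕ) : (L.T)^[m] (s2 y) ∉ L.Sig :=
  fun h => hnc ⟨s2 y, mem_image_of_mem _ hy, m, h⟩

theorem exists_coding_s2 (hnc : ¬ L.HasConnection) {y : ℝ × Bool} (hy : y ∈ L.Sig) (m : ℕ) :
    ∃ v, v.length = m ∧ s2 y ∈ L.cyl v :=
  exists_coding (s2_mem_Ihat.mpr (L.Sig_sub hy)) fun j _ => iterate_s2_not_mem_Sig hnc hy j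

/-- If the orbit of `s2 z` meets `Σ`, then `z` is in the orbit of a point of `σ₂(Σ)`. -/
theorem exists_iterate_eq {z : ℝ × Bool} (hz : z ∈ L.Ihat) {j : ℕ}
    (h : (L.T)^[j] (s2 z) ∈ L.Sig) : ∃ x ∈ s2 '' L.Sig, ∃ m : ℕ, (L.T)^[m] x = z := by
  induction j generalizing z with
  | zero => exact ⟨z, ⟨s2 z, h, s2_s2 z⟩, 0, rfl⟩
  | succ j ih =>
    by_cases hs : s2 z ∈ L.Sig
    · exact ⟨z, ⟨s2 z, hs, s2_s2 z⟩, 0, rfl⟩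
    obtain ⟨c, hc⟩ := exists_mem_Ia (s2_mem_Ihat.mpr hz) hs
    obtain ⟨x, hx, m, hm⟩ := ih (z := L.s1 (s2 z)) (Ia_subset_Ihat _ (s1_mem_Ia hc)) h
    refine ⟨x, hx, m + 1, ?_⟩
    rw [Function.iterate_succ_apply', hm, T_s1 hc, s2_s2]

/-- Without connection, either the future or the past of a point is coded up to any order. -/
theorem exists_coding_or (hnc : ¬ L.HasConnection) {z : ℝ × Bool} (hz : z ∈ L.Ihat) (m : ℕ) :
    (∃ v, v.length = m ∧ z ∈ L.cyl v) ∨ ∃ q, q.length = m ∧ s2 z ∈ L.cyl q := by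
  by_contra! hcon
  have h1 : ∃ j < m, (L.T)^[j] z ∈ L.Sig := by
    by_contra! h
    obtain ⟨v, hv, hzv⟩ := exists_coding hz h
    exact hcon.1 v hv hzv
  have h2 : ∃ j < m, (L.T)^[j] (s2 z) ∈ L.Sig := by
    by_contra! h
    obtain ⟨v, hv, hzv⟩ := exists_coding (s2_mem_Ihat.mpr hz) h
    exact hcon.2 v hv hzv
  obtain ⟨i, -, hi⟩ := h1
  obtain ⟨j, -, hj⟩ := h2
  obtain ⟨x, hx, k, rfl⟩ := exists_iterate_eq hz hj
  exact hnc ⟨x, hx, i + k, by rwa [Function.iterate_add_apply]⟩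

/-- On a one-letter alphabet a linear involution without connection has no division point. -/
theorem Sig_eq_empty_of_subsingleton [Subsingleton A] (hnc : ¬ L.HasConnection) :
    L.Sig = ∅ := by
  rw [eq_empty_iff_forall_notMem]
  intro y hy
  have hI : ∀ m, (L.T)^[m] (s2 y) ∈ L.Ihat := fun m =>
    iterate_mem_Ihat (s2_mem_Ihat.mpr (L.Sig_sub hy)) fun j _ => iterate_s2_not_mem_Sig hnc hy j
  have hmem : ∀ m, ∃ c, (L.T)^[m] (s2 y) ∈ L.Ia c := fun m =>
    exists_mem_Ia (hI m) (iterate_s2_not_mem_Sig hnc hy m)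
  obtain ⟨c, hc⟩ := hmem 0
  have hall : ∀ m, (L.T)^[m] (s2 y) ∈ L.Ia c := by
    intro m
    induction m with
    | zero => exact hc
    | succ m ih =>
      obtain ⟨d, hd⟩ := hmem (m + 1)
      have hne : d ≠ Letter.inv c := by
        rintro rfl
        rw [Function.iterate_succ_apply'] at hd
        exact T_not_mem ih hd
      have : d = c := by
        refine Prod.ext (Subsingleton.elim _ _) ?_
        by_contra h
        exact hne (Prod.ext (Subsingleton.elim _ _) (by
          simp only [Letter.inv]
          cases h1 : d.2 <;> cases h2 : c.2 <;> simp_all))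
      rwa [this] at hd
  change s2 y ∈ L.Ia c at hc
  have hnot : ∀ z d, z ∈ L.Ia d → L.T z ≠ s2 y := by
    intro z d hz h
    have h1 := s1_mem_Ia hz
    rw [← s2_T, h, s2_s2] at h1
    exact not_mem_Sig h1 hy
  have h1 : L.T (s2 y) ∈ L.Ia c := hall 1
  have hcomp : (!L.comp (Letter.inv c)) = (s2 y).2 := by
    have e1 := (mem_Ia.mp h1).2
    have e2 := (mem_Ia.mp hc).2
    rw [e2, ← e1]
    rcases T_affine (L := L) c with ⟨α, h⟩ | ⟨α, h⟩ <;> rw [h _ hc]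
  rcases T_affine (L := L) c with ⟨α, h⟩ | ⟨α, h⟩
  · have hval : ∀ m : ℕ, ((L.T)^[m] (s2 y)).1 = (s2 y).1 + m * α := by
      intro m
      induction m with
      | zero => simp
      | succ m ih =>
        rw [Function.iterate_succ_apply', h _ (hall m)]
        push_cast
        linarith
    have hα : α ≠ 0 := by
      rintro rfl
      apply hnot _ _ hc
      rw [h _ hc, hcomp]
      simp
    obtain ⟨m, hm⟩ := exists_nat_gt ((L.hi - L.lo) / |α|)
    rw [div_lt_iff₀ (abs_pos.mpr hα)] at hm
    have e0 := mem_Ihat.mp (hI 0)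
    have em := mem_Ihat.mp (hI m)
    rw [hval m] at em
    simp only [Function.iterate_zero, id] at e0
    have h3 : |(m : ℝ) * α| < L.hi - L.lo := by
      rw [abs_lt]
      constructor <;> linarith [e0.1, e0.2, em.1, em.2]
    rw [abs_mul, Nat.abs_cast] at h3
    linarith
  · apply hnot _ _ h1
    rw [h _ h1, h _ hc, hcomp]
    simp

theorem Sig_finite [Nonempty A] (hnc : ¬ L.HasConnection) : L.Sig.Finite := by
  by_cases hA : Subsingleton A
  · rw [Sig_eq_empty_of_subsingleton hnc]
    exact finite_empty
  · have h2 : 1 < Fintype.card A := by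
      rw [Fintype.one_lt_card_iff_nontrivial]
      exact not_subsingleton_iff_nontrivial.mp hA
    apply finite_of_ncard_ne_zero
    rw [L.Sig_card]
    omega

end NoConnection

section Extensions

variable {L}

/-- An interval without division point meeting `I_c` is contained in `I_c`. -/
theorem subset_Ia_of_inter_nonempty {C : Set ℝ} {δ : Bool} {c : Letter A}
    (hC : C.OrdConnected) (hsub : C ⊆ Ioo L.lo L.hi)
    (hSig : ∀ y ∈ L.Sig, y ∉ C ×ˢ ({δ} : Set Bool))
    (hne : (L.Ia c ∩ C ×ˢ {δ}).Nonempty) : C ×ˢ {δ} ⊆ L.Ia c := by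
  have hopen : ∀ d, IsOpen {t : ℝ | (t, δ) ∈ L.Ia d} := fun d =>
    (cyl_singleton (L := L) d ▸ isOpen_cyl [d] : IsOpen (L.Ia d)).preimage (by fun_prop)
  have h : C ⊆ {t : ℝ | (t, δ) ∈ L.Ia c} := by
    refine hC.isPreconnected.subset_left_of_subset_union (hopen c)
      (isOpen_iUnion fun d => isOpen_iUnion fun _ : d ≠ c => hopen d) ?_ ?_ ?_
    · rw [Set.disjoint_left]
      intro t ht ht'
      simp only [mem_iUnion, mem_ofPred_eq] at ht ht'
      obtain ⟨d, hd, hd'⟩ := ht'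
      exact hd (Ia_unique hd' ht)
    · intro t ht
      obtain ⟨d, hd⟩ := exists_mem_Ia (L := L) (z := (t, δ)) (mem_Ihat.mpr (hsub ht))
        fun h => hSig _ h ⟨ht, rfl⟩
      by_cases hdc : d = c
      · subst hdc
        exact Or.inl hd
      · right
        simp only [mem_iUnion, mem_ofPred_eq]
        exact ⟨d, hdc, hd⟩
    · obtain ⟨⟨t, ε⟩, ht, htC, hε⟩ := hne
      cases hε
      exact ⟨t, htC, ht⟩
  rintro ⟨t, ε⟩ ⟨ht, hε⟩
  cases hε
  exact h ht

open Classical in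
/-- An open interval containing `s` division points meets exactly `s + 1` intervals `I_c`. -/
theorem card_meeting_eq (F : Finset (ℝ × Bool)) (hF : ∀ y, y ∈ F ↔ y ∈ L.Sig) {δ : Bool}
    {C : Set ℝ} (hCo : IsOpen C) (hCc : C.OrdConnected) (hCn : C.Nonempty)
    (hsub : C ⊆ Ioo L.lo L.hi) :
    (Finset.univ.filter fun c => (L.Ia c ∩ C ×ˢ {δ}).Nonempty).card =
      1 + (F.filter fun y => y ∈ C ×ˢ ({δ} : Set Bool)).card := by
  generalize hs : (F.filter fun y => y ∈ C ×ˢ ({δ} : Set Bool)).card = s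
  induction s using Nat.strong_induction_on generalizing C with
  | _ s ih =>
  by_cases hcut : ∃ p ∈ L.Sig, p ∈ C ×ˢ ({δ} : Set Bool)
  · obtain ⟨⟨p, ε⟩, hp, hpC, hε⟩ := hcut
    obtain rfl : δ = ε := (mem_singleton_iff.mp hε).symm
    dsimp only at hpC
    obtain ⟨l, hl, hlC⟩ : ∃ l < p, l ∈ C := by
      obtain ⟨l, hl, h⟩ := exists_Ioc_subset_of_mem_nhds (hCo.mem_nhds hpC) ⟨p - 1, by linarith⟩
      exact ⟨(l + p) / 2, by linarith, h ⟨by linarith, by linarith⟩⟩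
    obtain ⟨r, hr, hrC⟩ : ∃ r > p, r ∈ C := by
      obtain ⟨r, hr, h⟩ := exists_Ico_subset_of_mem_nhds (hCo.mem_nhds hpC) ⟨p + 1, by linarith⟩
      exact ⟨(p + r) / 2, by linarith, h ⟨by linarith, by linarith⟩⟩
    obtain ⟨D, hD⟩ : ∃ D, D = C ∩ Iio p := ⟨_, rfl⟩
    obtain ⟨E, hE⟩ : ∃ E, E = C ∩ Ioi p := ⟨_, rfl⟩
    have hDm : ∀ t, t ∈ D ↔ t ∈ C ∧ t < p := fun t => by rw [hD]; rfl
    have hEm : ∀ t, t ∈ E ↔ t ∈ C ∧ p < t := fun t => by rw [hE]; rfl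
    have e : F.filter (fun y => y ∈ C ×ˢ ({δ} : Set Bool)) =
        insert (p, δ) (F.filter (fun y => y ∈ D ×ˢ ({δ} : Set Bool)) ∪
          F.filter (fun y => y ∈ E ×ˢ ({δ} : Set Bool))) := by
      ext ⟨t, ε⟩
      simp only [Finset.mem_filter, Finset.mem_insert, Finset.mem_union, mem_prod, hDm, hEm,
        mem_singleton_iff, Prod.mk.injEq]
      constructor
      · rintro ⟨h1, h2, rfl⟩
        rcases lt_trichotomy t p with h | h | h
        · exact Or.inr (Or.inl ⟨h1, ⟨h2, h⟩, rfl⟩)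
        · exact Or.inl ⟨h, rfl⟩
        · exact Or.inr (Or.inr ⟨h1, ⟨h2, h⟩, rfl⟩)
      · rintro (⟨rfl, rfl⟩ | ⟨h1, ⟨h2, _⟩, rfl⟩ | ⟨h1, ⟨h2, _⟩, rfl⟩)
        · exact ⟨(hF _).mpr hp, hpC, rfl⟩
        · exact ⟨h1, h2, rfl⟩
        · exact ⟨h1, h2, rfl⟩
    have hd : Disjoint (F.filter (fun y => y ∈ D ×ˢ ({δ} : Set Bool)))
        (F.filter (fun y => y ∈ E ×ˢ ({δ} : Set Bool))) := by
      rw [Finset.disjoint_left]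
      intro y h1 h2
      rw [Finset.mem_filter] at h1 h2
      exact lt_asymm ((hDm _).mp h1.2.1).2 ((hEm _).mp h2.2.1).2
    have hcard := congrArg Finset.card e
    rw [Finset.card_insert_of_notMem (by simp [hDm, hEm]), Finset.card_union_of_disjoint hd,
      hs] at hcard
    have ih1 := ih _ (by omega) (hD ▸ hCo.inter isOpen_Iio) (hD ▸ hCc.inter ordConnected_Iio)
      ⟨l, (hDm l).mpr ⟨hlC, hl⟩⟩ (hD ▸ inter_subset_left.trans hsub) rfl
    have ih2 := ih _ (by omega) (hE ▸ hCo.inter isOpen_Ioi) (hE ▸ hCc.inter ordConnected_Ioi)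
      ⟨r, (hEm r).mpr ⟨hrC, hr⟩⟩ (hE ▸ inter_subset_left.trans hsub) rfl
    have e' : (Finset.univ.filter fun c => (L.Ia c ∩ C ×ˢ {δ}).Nonempty) =
        (Finset.univ.filter fun c => (L.Ia c ∩ D ×ˢ {δ}).Nonempty) ∪
        (Finset.univ.filter fun c => (L.Ia c ∩ E ×ˢ {δ}).Nonempty) := by
      ext c
      simp only [Finset.mem_filter, Finset.mem_univ, true_and, Finset.mem_union]
      constructor
      · rintro ⟨⟨t, ε⟩, ht, htC, hε⟩
        obtain rfl : δ = ε := (mem_singleton_iff.mp hε).symm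
        rcases lt_trichotomy t p with h | h | h
        · exact Or.inl ⟨(t, δ), ht, (hDm t).mpr ⟨htC, h⟩, rfl⟩
        · exact absurd (h ▸ hp) (not_mem_Sig ht)
        · exact Or.inr ⟨(t, δ), ht, (hEm t).mpr ⟨htC, h⟩, rfl⟩
      · rintro (⟨z, hz, h, h'⟩ | ⟨z, hz, h, h'⟩)
        · exact ⟨z, hz, ((hDm _).mp h).1, h'⟩
        · exact ⟨z, hz, ((hEm _).mp h).1, h'⟩
    have hd' : Disjoint
        (Finset.univ.filter fun c => (L.Ia c ∩ D ×ˢ {δ}).Nonempty)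
        (Finset.univ.filter fun c => (L.Ia c ∩ E ×ˢ {δ}).Nonempty) := by
      rw [Finset.disjoint_left]
      intro c h1 h2
      obtain ⟨⟨t, ε⟩, ht, htp, hε⟩ := (Finset.mem_filter.mp h1).2
      obtain ⟨⟨t', ε'⟩, ht', htp', hε'⟩ := (Finset.mem_filter.mp h2).2
      obtain rfl : δ = ε := (mem_singleton_iff.mp hε).symm
      obtain rfl : δ = ε' := (mem_singleton_iff.mp hε').symm
      rw [mem_Ia] at ht ht'
      refine not_mem_Sig (c := c) (z := (p, δ)) (mem_Ia.mpr ⟨⟨?_, ?_⟩, ht.2⟩) hp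
      · exact ht.1.1.trans ((hDm _).mp htp).2
      · exact lt_trans ((hEm _).mp htp').2 ht'.1.2
    rw [e', Finset.card_union_of_disjoint hd']
    omega
  · push Not at hcut
    have h0 : s = 0 := by
      rw [← hs, Finset.card_eq_zero, Finset.filter_eq_empty_iff]
      exact fun y hy => hcut y ((hF y).mp hy)
    rw [h0, add_zero, Finset.card_eq_one]
    obtain ⟨t, ht⟩ := hCn
    obtain ⟨c, hc⟩ := exists_mem_Ia (L := L) (z := (t, δ)) (mem_Ihat.mpr (hsub ht))
      fun h => hcut _ h ⟨ht, rfl⟩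
    refine ⟨c, ?_⟩
    ext d
    simp only [Finset.mem_filter, Finset.mem_univ, true_and, Finset.mem_singleton]
    constructor
    · intro hd
      have h1 : ((t, δ) : ℝ × Bool) ∈ C ×ˢ ({δ} : Set Bool) := ⟨ht, rfl⟩
      exact Ia_unique (subset_Ia_of_inter_nonempty hCc hsub hcut hd h1) hc
    · rintro rfl
      exact ⟨(t, δ), hc, ht, rfl⟩

theorem cyl_cons_nonempty_iff {c : Letter A} {v : List (Letter A)} :
    (L.cyl (c :: v)).Nonempty ↔ (L.Ia (Letter.inv c) ∩ s2 ⁻¹' L.cyl v).Nonempty := by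
  constructor
  · rintro ⟨z, hz, hT⟩
    exact ⟨L.s1 z, s1_mem_Ia hz, hT⟩
  · rintro ⟨z, hz, hT⟩
    have h := s1_mem_Ia hz
    rw [Letter.inv_inv] at h
    refine ⟨L.s1 z, h, ?_⟩
    rw [mem_preimage, T_s1 hz]
    exact hT

theorem s2_preimage_prod (C : Set ℝ) (δ : Bool) :
    s2 ⁻¹' (C ×ˢ {δ}) = C ×ˢ ({!δ} : Set Bool) := by
  ext ⟨t, ε⟩
  cases δ <;> cases ε <;> simp [s2]

theorem subset_Ioo_of_cyl_eq {v : List (Letter A)} {C : Set ℝ} {δ : Bool}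
    (h : L.cyl v = C ×ˢ {δ}) : C ⊆ Ioo L.lo L.hi := fun t ht =>
  mem_Ihat.mp (cyl_subset_Ihat (L := L) v (h ▸ ⟨ht, rfl⟩ : (t, δ) ∈ L.cyl v))

open Classical in
/-- The number of left extensions of a nonempty word `v` of the language is one more than the
number of singularities of `T⁻¹` in its cylinder. -/
theorem card_left_extensions (F : Finset (ℝ × Bool)) (hF : ∀ y, y ∈ F ↔ y ∈ L.Sig)
    {v : List (Letter A)} (hv : v ≠ []) (hne : (L.cyl v).Nonempty) :
    (Finset.univ.filter fun c => (L.cyl (c :: v)).Nonempty).card =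
      1 + (F.filter fun y => s2 y ∈ L.cyl v).card := by
  obtain ⟨C, δ, hCo, hCc, h⟩ := cyl_eq_prod (L := L) hv
  have hCn : C.Nonempty := by
    rw [h] at hne
    exact hne.fst
  have hpre : s2 ⁻¹' L.cyl v = C ×ˢ ({!δ} : Set Bool) := by rw [h, s2_preimage_prod]
  have key := card_meeting_eq F hF (δ := !δ) hCo hCc hCn (subset_Ioo_of_cyl_eq h)
  have hcongr : (F.filter fun y => s2 y ∈ L.cyl v) =
      F.filter fun y => y ∈ C ×ˢ ({!δ} : Set Bool) :=
    Finset.filter_congr fun y _ => by rw [← hpre]; rfl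
  rw [hcongr, ← key]
  refine Finset.card_bij (fun c _ => Letter.inv c) ?_ ?_ ?_
  · intro c hc
    simpa [cyl_cons_nonempty_iff, hpre] using hc
  · intro c _ d _ h
    rw [← Letter.inv_inv c, h, Letter.inv_inv]
  · intro d hd
    refine ⟨Letter.inv d, ?_, Letter.inv_inv d⟩
    simpa [cyl_cons_nonempty_iff, Letter.inv_inv, hpre] using hd

/-- The set `U` contains an open horizontal interval of length at least `ε`. -/
def ContainsInterval (ε : ℝ) (U : Set (ℝ × Bool)) : Prop :=
  ∃ (a b : ℝ) (δ : Bool), a + ε ≤ b ∧ Ioo a b ×ˢ {δ} ⊆ U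

theorem exists_containsInterval_cyl {v : List (Letter A)} (hv : v ≠ [])
    (hne : (L.cyl v).Nonempty) : ∃ ε > 0, ContainsInterval ε (L.cyl v) := by
  obtain ⟨C, δ, hCo, -, h⟩ := cyl_eq_prod (L := L) hv
  rw [h] at hne ⊢
  obtain ⟨t, ht⟩ := hne.fst
  obtain ⟨ε, hε, hball⟩ := Metric.isOpen_iff.mp hCo t ht
  rw [Real.ball_eq_Ioo] at hball
  exact ⟨ε, hε, t - ε, t + ε, δ, by linarith, prod_mono hball subset_rfl⟩

/-- If the cylinder of `v` contains no singularity of `T⁻¹`, the cylinder of its left extension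
contains intervals of the same length. -/
theorem ContainsInterval.cyl_cons {ε : ℝ} {v : List (Letter A)} {c : Letter A} (hv : v ≠ [])
    (h : ContainsInterval ε (L.cyl v)) (hcut : ∀ y ∈ L.Sig, s2 y ∉ L.cyl v)
    (hne : (L.cyl (c :: v)).Nonempty) : ContainsInterval ε (L.cyl (c :: v)) := by
  obtain ⟨C, δ, hCo, hCc, hC⟩ := cyl_eq_prod (L := L) hv
  have hpre : s2 ⁻¹' L.cyl v = C ×ˢ ({!δ} : Set Bool) := by rw [hC, s2_preimage_prod]
  have hsub : s2 ⁻¹' L.cyl v ⊆ L.Ia (Letter.inv c) := by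
    rw [cyl_cons_nonempty_iff] at hne
    rw [hpre] at hne ⊢
    refine subset_Ia_of_inter_nonempty hCc (subset_Ioo_of_cyl_eq hC) ?_ hne
    rw [← hpre]
    exact hcut
  obtain ⟨a, b, δ', hab, hI⟩ := h
  have key : ∀ t ∈ Ioo a b, L.s1 (t, !δ') ∈ L.cyl (c :: v) := by
    intro t ht
    have h1 : s2 (t, !δ') ∈ L.cyl v := hI ⟨ht, by simp [s2]⟩
    have h2 := hsub h1
    have h3 := s1_mem_Ia h2
    rw [Letter.inv_inv] at h3
    refine ⟨h3, ?_⟩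
    rw [mem_preimage, T_s1 h2]
    exact h1
  have hmem : ∀ t ∈ Ioo a b, (t, !δ') ∈ L.Ia (Letter.inv c) := fun t ht =>
    hsub (show s2 (t, !δ') ∈ L.cyl v from hI ⟨ht, by simp [s2]⟩)
  rcases L.s1_iso (Letter.inv c) with ⟨α, h⟩ | ⟨α, h⟩
  · refine ⟨a + α, b + α, L.comp (Letter.inv (Letter.inv c)), by linarith, ?_⟩
    rintro ⟨t, η⟩ ⟨ht, hη⟩
    cases hη
    have ht' : t - α ∈ Ioo a b := ⟨by linarith [ht.1], by linarith [ht.2]⟩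
    have := key _ ht'
    rw [h _ (hmem _ ht')] at this
    simpa using this
  · refine ⟨-b + α, -a + α, L.comp (Letter.inv (Letter.inv c)), by linarith, ?_⟩
    rintro ⟨t, η⟩ ⟨ht, hη⟩
    cases hη
    have ht' : α - t ∈ Ioo a b := ⟨by linarith [ht.2], by linarith [ht.1]⟩
    have := key _ ht'
    rw [h _ (hmem _ ht')] at this
    simpa using this

/-- There is no infinite family of pairwise disjoint cylinders containing intervals of
length bounded below. -/
theorem exists_ne_inter_nonempty {ε : ℝ} (hε : 0 < ε) (f : ℕ → List (Letter A))
    (hf : ∀ m, ContainsInterval ε (L.cyl (f m))) :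
    ∃ i j, i ≠ j ∧ (L.cyl (f i) ∩ L.cyl (f j)).Nonempty := by
  choose a b δ hab hI using hf
  have hmid : ∀ m, ∀ t ∈ Ioo (a m) (b m), t ∈ Ioo L.lo L.hi := fun m t ht =>
    mem_Ihat.mp (cyl_subset_Ihat (L := L) _ (hI m
      (⟨ht, rfl⟩ : ((t, δ m) : ℝ × Bool) ∈ Ioo (a m) (b m) ×ˢ ({δ m} : Set Bool))))
  have ha : ∀ m, L.lo - ε ≤ a m ∧ a m ≤ L.hi := by
    intro m
    have h := hmid m (a m + ε / 2) ⟨by linarith, by linarith [hab m]⟩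
    exact ⟨by linarith [h.1], by linarith [h.2]⟩
  have hfl : ∀ m, ⌊a m / ε⌋ ∈ Icc ⌊(L.lo - ε) / ε⌋ ⌊L.hi / ε⌋ := fun m =>
    ⟨Int.floor_le_floor (by have := (ha m).1; gcongr),
      Int.floor_le_floor (by have := (ha m).2; gcongr)⟩
  obtain ⟨i, j, hij, h⟩ := Finite.exists_ne_map_eq_of_infinite
    (fun m => ((⟨⌊a m / ε⌋, hfl m⟩, δ m) : Icc ⌊(L.lo - ε) / ε⌋ ⌊L.hi / ε⌋ × Bool))
  rw [Prod.mk.injEq, Subtype.mk.injEq] at h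
  refine ⟨i, j, hij, ?_⟩
  have habs := Int.abs_sub_lt_one_of_floor_eq_floor h.1
  rw [← sub_div, abs_div, abs_of_pos hε, div_lt_one hε, abs_lt] at habs
  obtain ⟨t, ht1, ht2⟩ : ∃ t, max (a i) (a j) < t ∧ t < min (b i) (b j) :=
    exists_between (max_lt (lt_min (by linarith [hab i]) (by linarith [hab j]))
      (lt_min (by linarith [hab i]) (by linarith [hab j])))
  rw [max_lt_iff] at ht1
  rw [lt_min_iff] at ht2
  exact ⟨(t, δ i), hI i ⟨⟨ht1.1, ht2.1⟩, rfl⟩, hI j ⟨⟨ht1.2, ht2.2⟩, h.2⟩⟩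

end Extensions

section Returns

variable {L} {X : Set (List (Letter A))} {n N : ℕ}

theorem eq_of_mem_cyl_of_firstOcc {u v : List (Letter A)} {z : ℝ × Bool}
    (hu : u ∈ FirstOcc X) (hv : v ∈ FirstOcc X) (hzu : z ∈ L.cyl u) (hzv : z ∈ L.cyl v) :
    u = v := by
  rcases le_total u.length v.length with h | h
  · exact FirstOcc.eq_of_prefix hu hv (prefix_of_mem_cyl hzu hzv h)
  · exact (FirstOcc.eq_of_prefix hv hu (prefix_of_mem_cyl hzv hzu h)).symm

/-- Words of the language ending with their only occurrence of an element of `X` can be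
shortened on the left. -/
theorem exists_firstOcc_of_length_eq (hX : ∀ x ∈ X, x.length = n) {m : ℕ} (hm : n ≤ m)
    {v : List (Letter A)} (hne : (L.cyl v).Nonempty) (hv : v ∈ FirstOcc X)
    (hlen : m ≤ v.length) :
    ∃ u ∈ FirstOcc X, (L.cyl u).Nonempty ∧ u.length = m := by
  induction v with
  | nil => exact ⟨[], hv, hne, (Nat.le_zero.mp hlen).symm⟩
  | cons c v ih =>
    rcases hlen.eq_or_lt with h | h
    · exact ⟨_, hv, hne, h.symm⟩
    · have hmv : m ≤ v.length := Nat.lt_succ_iff.mp h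
      exact ih (cyl_nonempty_of_infix (List.suffix_cons c v).isInfix hne)
        ((firstOcc_or_completeFirstReturn (S := Set.univ) hX (hm.trans hmv)
          (Set.mem_univ _)).mp (Or.inl hv)) hmv

/-- The words of the language ending with their only occurrence of an element of `X` have
bounded length. -/
theorem exists_firstOcc_length_lt (hfin : L.Sig.Finite) (hX : ∀ x ∈ X, x.length = n)
    (hn : 0 < n) :
    ∃ N, n ≤ N ∧ ∀ v ∈ FirstOcc X, (L.cyl v).Nonempty → v.length < N := by
  have hnil : [] ∉ X := fun h => hn.ne (hX _ h)
  obtain ⟨M, hnM, hM⟩ : ∃ M, n ≤ M ∧ ∀ v ∈ FirstOcc X, M ≤ v.length →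
      ∀ y ∈ L.Sig, s2 y ∉ L.cyl v := by
    have : ∀ y, ∃ b, ∀ v ∈ FirstOcc X, s2 y ∈ L.cyl v → v.length ≤ b := by
      intro y
      by_cases h : ∃ v ∈ FirstOcc X, s2 y ∈ L.cyl v
      · obtain ⟨v, hv, hy⟩ := h
        exact ⟨v.length, fun u hu hyu =>
          (congrArg List.length (eq_of_mem_cyl_of_firstOcc hu hv hyu hy)).le⟩
      · exact ⟨0, fun v hv hy => absurd ⟨v, hv, hy⟩ h⟩
    choose b hb using this
    obtain ⟨B, hB⟩ := (hfin.image b).bddAbove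
    refine ⟨n + B + 1, by omega, fun v hv hlen y hy hyv => ?_⟩
    have h1 := hb y v hv hyv
    have h2 : b y ≤ B := hB (mem_image_of_mem b hy)
    omega
  by_contra! hcon
  have hP : ∀ m, ∃ v ∈ FirstOcc X, (L.cyl v).Nonempty ∧ v.length = M + m := by
    intro m
    obtain ⟨v, hv, hne, hlen⟩ := hcon (M + m) (by omega)
    exact exists_firstOcc_of_length_eq hX (by omega) hne hv hlen
  choose f hfX hfne hflen using hP
  obtain ⟨ε, hε0, hε⟩ : ∃ ε > 0, ∀ v ∈ FirstOcc X, (L.cyl v).Nonempty → v.length = M →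
      ContainsInterval ε (L.cyl v) := by
    have hev : ∀ v ∈ {v : List (Letter A) | v.length = M}, ∀ᶠ ε in nhdsWithin (0 : ℝ) (Ioi 0),
        v ∈ FirstOcc X → (L.cyl v).Nonempty → ContainsInterval ε (L.cyl v) := by
      intro v _
      by_cases h : v ∈ FirstOcc X ∧ (L.cyl v).Nonempty
      · obtain ⟨ε, hε, a, b, δ, hab, hI⟩ :=
          exists_containsInterval_cyl (FirstOcc.ne_nil hnil h.1) h.2
        filter_upwards [Ioo_mem_nhdsGT hε] with η hη _ _
        exact ⟨a, b, δ, by linarith [hη.2], hI⟩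
      · exact Filter.Eventually.of_forall fun _ h1 h2 => absurd ⟨h1, h2⟩ h
    obtain ⟨ε, h, h0⟩ := (((Set.Finite.eventually_all (List.finite_length_eq (Letter A) M)).mpr
      hev).and self_mem_nhdsWithin).exists
    exact ⟨ε, h0, fun v hv hne hlen => h v hlen hv hne⟩
  have hall : ∀ m, ∀ v ∈ FirstOcc X, (L.cyl v).Nonempty → v.length = M + m →
      ContainsInterval ε (L.cyl v) := by
    intro m
    induction m with
    | zero => exact hε
    | succ m ih =>
      intro v hv hne hlen
      obtain ⟨c, v, rfl⟩ := List.exists_cons_of_ne_nil (FirstOcc.ne_nil hnil hv)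
      have hlen' : v.length = M + m := by simpa [← add_assoc] using hlen
      have hv' : v ∈ FirstOcc X := (firstOcc_or_completeFirstReturn (S := Set.univ) hX
        (by omega) (Set.mem_univ _)).mp (Or.inl hv)
      exact (ih v hv' (cyl_nonempty_of_infix (List.suffix_cons c v).isInfix hne)
        hlen').cyl_cons (FirstOcc.ne_nil hnil hv') (hM v hv' (by omega)) hne
  obtain ⟨i, j, hij, z, hzi, hzj⟩ := exists_ne_inter_nonempty hε0 f fun m =>
    hall m _ (hfX m) (hfne m) (hflen m)
  have h := congrArg List.length (eq_of_mem_cyl_of_firstOcc (hfX i) (hfX j) hzi hzj)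
  rw [hflen, hflen] at h
  omega

theorem exists_infix_of_prefix (hN : ∀ v ∈ FirstOcc X, (L.cyl v).Nonempty → v.length < N)
    {u p : List (Letter A)} (hu : (L.cyl u).Nonempty) (hx : ∃ x ∈ X, x <:+: u)
    (hp : p <+: u) (hlen : N ≤ p.length) : ∃ x ∈ X, x <:+: p := by
  obtain ⟨q, hq, hqu⟩ := exists_prefix_firstOcc u hx
  have h := hN q hq (cyl_nonempty_of_infix hqu.isInfix hu)
  obtain ⟨x, hxX, hxq⟩ := hq.1
  exact ⟨x, hxX, hxq.isInfix.trans
    (List.prefix_of_prefix_length_le hqu hp (by omega)).isInfix⟩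

theorem exists_infix_of_suffix (hN : ∀ v ∈ FirstOcc X, (L.cyl v).Nonempty → v.length < N)
    (hXinv : ∀ x ∈ X, wordInv x ∈ X)
    {u s : List (Letter A)} (hu : (L.cyl u).Nonempty) (hx : ∃ x ∈ X, x <:+: u)
    (hs : s <:+ u) (hlen : N ≤ s.length) : ∃ x ∈ X, x <:+: s := by
  have hs' : wordInv s <+: wordInv u := by
    obtain ⟨p, rfl⟩ := hs
    exact ⟨wordInv p, (wordInv_append p s).symm⟩
  have := exists_infix_wordInv hXinv (exists_infix_of_prefix hN (cyl_wordInv_nonempty hu)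
    (exists_infix_wordInv hXinv hx) hs' (by rwa [wordInv_length]))
  rwa [wordInv_wordInv] at this

/-- Long enough words of the language contain an element of the symmetric set `X`. -/
theorem exists_infix_of_length_eq (hnc : ¬ L.HasConnection)
    (hN : ∀ v ∈ FirstOcc X, (L.cyl v).Nonempty → v.length < N)
    (hXinv : ∀ x ∈ X, wordInv x ∈ X) {w : List (Letter A)} (hw : (L.cyl w).Nonempty)
    (hwX : ∃ x ∈ X, x <:+: w) (hwlen : w.length = N) {v : List (Letter A)}
    (hv : (L.cyl v).Nonempty) (hlen : v.length = N) : ∃ x ∈ X, x <:+: v := by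
  by_contra hbad
  have key : ∀ {q u : List (Letter A)} {z : ℝ × Bool}, q.length = N → u.length = N →
      s2 z ∈ L.cyl q → z ∈ L.cyl u → ((∃ x ∈ X, x <:+: q) ↔ ∃ x ∈ X, x <:+: u) := by
    intro q u z hq hu hzq hzu
    have hne := cyl_wordInv_append_nonempty hzq hzu
    constructor
    · intro h
      obtain ⟨x, hx, hxq⟩ := exists_infix_wordInv hXinv h
      exact exists_infix_of_suffix hN hXinv hne
        ⟨x, hx, hxq.trans (List.prefix_append _ _).isInfix⟩ (List.suffix_append _ _) hu.ge
    · rintro ⟨x, hx, hxu⟩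
      have := exists_infix_wordInv hXinv (exists_infix_of_prefix hN hne
        ⟨x, hx, hxu.trans (List.suffix_append _ _).isInfix⟩ (List.prefix_append _ _)
        (by rw [wordInv_length, hq]))
      rwa [wordInv_wordInv] at this
  let U : (List (Letter A) → Prop) → Set (ℝ × Bool) := fun R =>
    ⋃ u ∈ {u : List (Letter A) | u.length = N ∧ R u}, (L.cyl u ∪ s2 ⁻¹' L.cyl u)
  have hUm : ∀ R z, z ∈ U R ↔
      ∃ u : List (Letter A), u.length = N ∧ R u ∧ (z ∈ L.cyl u ∨ s2 z ∈ L.cyl u) := by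
    intro R z
    simp only [U, mem_iUnion, mem_ofPred_eq, mem_union, mem_preimage, exists_prop, and_assoc]
  have hs2 : Continuous s2 := by
    unfold s2
    fun_prop
  have hUo : ∀ R, IsOpen (U R) := fun R => isOpen_iUnion fun u => isOpen_iUnion fun _ =>
    (isOpen_cyl u).union ((isOpen_cyl u).preimage hs2)
  have hUs : ∀ R z, z ∈ U R → s2 z ∈ U R := by
    intro R z hz
    rw [hUm] at hz ⊢
    obtain ⟨u, h1, h2, h3⟩ := hz
    exact ⟨u, h1, h2, by rw [s2_s2]; exact h3.symm⟩
  let R : List (Letter A) → Prop := fun u => ∃ x ∈ X, x <:+: u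
  have hdisj : Disjoint (U R) (U fun u => ¬ R u) := by
    rw [Set.disjoint_left]
    intro z h1 h2
    rw [hUm] at h1 h2
    obtain ⟨u, hu, hgu, hzu⟩ := h1
    obtain ⟨q, hq, hgq, hzq⟩ := h2
    rcases hzu with hzu | hzu <;> rcases hzq with hzq | hzq
    · exact hgq (eq_of_mem_cyl hzu hzq (hu.trans hq.symm) ▸ hgu)
    · exact hgq ((key hq hu hzq hzu).mpr hgu)
    · exact hgq ((key hu hq hzu hzq).mp hgu)
    · exact hgq (eq_of_mem_cyl hzu hzq (hu.trans hq.symm) ▸ hgu)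
  have hcover : L.Ihat ⊆ U R ∪ U fun u => ¬ R u := by
    intro z hz
    have : ∃ u : List (Letter A), u.length = N ∧ (z ∈ L.cyl u ∨ s2 z ∈ L.cyl u) := by
      rcases exists_coding_or hnc hz N with ⟨u, h1, h2⟩ | ⟨u, h1, h2⟩
      · exact ⟨u, h1, Or.inl h2⟩
      · exact ⟨u, h1, Or.inr h2⟩
    obtain ⟨u, h1, h2⟩ := this
    by_cases h : R u
    · exact Or.inl ((hUm _ _).mpr ⟨u, h1, h, h2⟩)
    · exact Or.inr ((hUm _ _).mpr ⟨u, h1, h, h2⟩)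
  obtain ⟨z, hz⟩ := hw
  obtain ⟨z', hz'⟩ := hv
  have hzU : z ∈ U R := (hUm _ _).mpr ⟨w, hwlen, hwX, Or.inl hz⟩
  have hzU' : z' ∈ U fun u => ¬ R u := (hUm _ _).mpr ⟨v, hlen, hbad, Or.inl hz'⟩
  obtain ⟨z, hzI, hzU, hcomp⟩ : ∃ y ∈ L.Ihat, y ∈ U R ∧ y.2 = z'.2 := by
    by_cases h : z.2 = z'.2
    · exact ⟨z, cyl_subset_Ihat w hz, hzU, h⟩
    · exact ⟨s2 z, s2_mem_Ihat.mpr (cyl_subset_Ihat w hz), hUs _ _ hzU, by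
        rw [s2]
        exact (Bool.eq_not_of_ne (Ne.symm h)).symm⟩
  have hconn : IsPreconnected (Ioo L.lo L.hi ×ˢ ({z'.2} : Set Bool)) :=
    isPreconnected_Ioo.prod isPreconnected_singleton
  have hsub : Ioo L.lo L.hi ×ˢ ({z'.2} : Set Bool) ⊆ U R :=
    hconn.subset_left_of_subset_union (hUo _) (hUo _) hdisj
      ((prod_mono subset_rfl (subset_univ _)).trans hcover)
      ⟨z, ⟨hzI.1, hcomp⟩, hzU⟩
  exact Set.disjoint_left.mp hdisj (hsub ⟨(cyl_subset_Ihat v hz').1, rfl⟩) hzU'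

open Classical in
/-- If every singularity of `T⁻¹` lies in the cylinder of a word in `P`, where the cylinders of
the words of `P` are disjoint, then the number of left extensions of the words of `P` is
`Card(P) + Card(Σ)`. -/
theorem ncard_left_extensions (hfin : L.Sig.Finite) {P : Set (List (Letter A))}
    (hP : P.Finite) (hnil : [] ∉ P) (hne : ∀ v ∈ P, (L.cyl v).Nonempty)
    (hdisj : ∀ u ∈ P, ∀ v ∈ P, ∀ z, z ∈ L.cyl u → z ∈ L.cyl v → u = v)
    (hcov : ∀ y ∈ L.Sig, ∃ v ∈ P, s2 y ∈ L.cyl v) :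
    {u | ∃ c, ∃ v ∈ P, u = c :: v ∧ (L.cyl u).Nonempty}.ncard = P.ncard + L.Sig.ncard := by
  have hF : ∀ y, y ∈ hfin.toFinset ↔ y ∈ L.Sig := fun y => hfin.mem_toFinset
  have e1 : {u | ∃ c, ∃ v ∈ P, u = c :: v ∧ (L.cyl u).Nonempty} =
      ((hP.toFinset.sigma fun v => Finset.univ.filter fun c => (L.cyl (c :: v)).Nonempty).image
        fun p => p.2 :: p.1 : Finset (List (Letter A))) := by
    ext u
    simp only [mem_ofPred_eq, Finset.coe_image, mem_image, Finset.mem_coe, Finset.mem_sigma,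
      Finite.mem_toFinset, Finset.mem_filter, Finset.mem_univ, true_and, Sigma.exists]
    constructor
    · rintro ⟨c, v, hv, rfl, h⟩
      exact ⟨v, c, ⟨hv, h⟩, rfl⟩
    · rintro ⟨v, c, ⟨hv, h⟩, rfl⟩
      exact ⟨c, v, hv, rfl, h⟩
  have e2 : hfin.toFinset = hP.toFinset.biUnion fun v =>
      hfin.toFinset.filter fun y => s2 y ∈ L.cyl v := by
    ext y
    simp only [Finset.mem_biUnion, Finset.mem_filter, Finite.mem_toFinset]
    constructor
    · intro hy
      obtain ⟨v, hv, h⟩ := hcov y hy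
      exact ⟨v, hv, hy, h⟩
    · rintro ⟨_, _, hy, _⟩
      exact hy
  have e3 : L.Sig.ncard =
      ∑ v ∈ hP.toFinset, (hfin.toFinset.filter fun y => s2 y ∈ L.cyl v).card := by
    rw [ncard_eq_toFinset_card _ hfin, ← Finset.card_biUnion, ← e2]
    intro u hu v hv huv
    refine Finset.disjoint_left.mpr fun y h1 h2 => ?_
    exact huv (hdisj u (hP.mem_toFinset.mp hu) v (hP.mem_toFinset.mp hv) _
      (Finset.mem_filter.mp h1).2 (Finset.mem_filter.mp h2).2)
  rw [e1, ncard_coe_finset, Finset.card_image_of_injective, Finset.card_sigma, e3,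
    ncard_eq_toFinset_card _ hP, Finset.card_eq_sum_ones, ← Finset.sum_add_distrib]
  · refine Finset.sum_congr rfl fun v hv => ?_
    rw [hP.mem_toFinset] at hv
    exact card_left_extensions _ hF (fun h => hnil (h ▸ hv)) (hne v hv)
  · rintro ⟨v, c⟩ ⟨v', c'⟩ h
    rw [List.cons.injEq] at h
    obtain ⟨rfl, rfl⟩ := h
    rfl

/-- The number of complete first return words to a symmetric set `X` of words of length `n` of
the language of a linear involution without connection. -/
theorem ncard_completeFirstReturnWord (hnc : ¬ L.HasConnection) (hfin : L.Sig.Finite)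
    (hX : ∀ x ∈ X, x.length = n) (hn : 0 < n) (hXS : X ⊆ L.lang) (hXne : X.Nonempty)
    (hXinv : ∀ x ∈ X, wordInv x ∈ X) :
    {u | CompleteFirstReturnWord L.lang X u}.ncard = L.Sig.ncard + X.ncard := by
  obtain ⟨N, hnN, hN⟩ := exists_firstOcc_length_lt (L := L) hfin hX hn
  have hnil : [] ∉ X := fun h => hn.ne (hX _ h)
  set P : Set (List (Letter A)) := {v | v ∈ FirstOcc X ∧ (L.cyl v).Nonempty} with hPdef
  set E : Set (List (Letter A)) := {u | ∃ c, ∃ v ∈ P, u = c :: v ∧ (L.cyl u).Nonempty}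
  set C : Set (List (Letter A)) := {u | CompleteFirstReturnWord L.lang X u} with hCdef
  have hbound : ∀ {S : Set (List (Letter A))}, (∀ v ∈ S, v.length < N + 1) → S.Finite := fun h =>
    (List.finite_length_lt (Letter A) (N + 1)).subset h
  have hP : P.Finite := hbound fun v hv => (hN v hv.1 hv.2).trans N.lt_succ_self
  have hE : E.Finite := by
    refine hbound ?_
    rintro _ ⟨c, v, hv, rfl, -⟩
    exact Nat.succ_lt_succ (hN v hv.1 hv.2)
  have hXfin : X.Finite := hbound fun x hx => by
    rw [hX x hx]
    omega
  have hcov : ∀ y ∈ L.Sig, ∃ v ∈ P, s2 y ∈ L.cyl v := by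
    intro y hy
    obtain ⟨x, hx⟩ := hXne
    obtain ⟨w, hw, hwlen, hxw⟩ := exists_prefix_mem_lang hfin (hXS hx) ((hX x hx).trans_le hnN)
    obtain ⟨v, hv, hyv⟩ := exists_coding_s2 hnc hy N
    obtain ⟨p, hp, s, rfl⟩ := exists_prefix_firstOcc v
      (exists_infix_of_length_eq hnc hN hXinv ((mem_lang_iff hfin).mp hw)
        ⟨x, hx, hxw.isInfix⟩ hwlen ⟨_, hyv⟩ hv)
    have hyp := (mem_cyl_append.mp hyv).1
    exact ⟨p, ⟨hp, _, hyp⟩, hyp⟩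
  have hcard : E.ncard = P.ncard + L.Sig.ncard :=
    ncard_left_extensions hfin hP (fun h => FirstOcc.ne_nil hnil h.1 rfl) (fun v hv => hv.2)
      (fun u hu v hv z => eq_of_mem_cyl_of_firstOcc hu.1 hv.1) hcov
  have hsplit : ∀ {c v}, n ≤ v.length → (L.cyl (c :: v)).Nonempty →
      ((c :: v ∈ P ∨ c :: v ∈ C) ↔ v ∈ P) := by
    intro c v hlen hne
    have h := firstOcc_or_completeFirstReturn (S := L.lang) hX hlen ((mem_lang_iff hfin).mpr hne)
    have hv := cyl_nonempty_of_infix (List.suffix_cons c v).isInfix hne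
    simpa only [hPdef, hCdef, mem_ofPred_eq, hne, hv, and_true] using h
  have hunion : E ∪ X = P ∪ C := by
    ext u
    simp only [mem_union]
    constructor
    · rintro (⟨c, v, hv, rfl, hne⟩ | hu)
      · exact (hsplit (FirstOcc.le_length hX hv.1) hne).mpr hv
      · exact Or.inl ⟨(mem_firstOcc_of_length_eq hX (hX u hu)).mpr hu,
          (mem_lang_iff hfin).mp (hXS hu)⟩
    · intro hu
      have hne : (L.cyl u).Nonempty := hu.elim (fun h => h.2) fun h => (mem_lang_iff hfin).mp h.1.1
      have hlen : n ≤ u.length := hu.elim (fun h => FirstOcc.le_length hX h.1) fun h =>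
        (h.length_lt hX).le
      rcases hlen.eq_or_lt with hlen | hlen
      · right
        rcases hu with hu | hu
        · exact (mem_firstOcc_of_length_eq hX hlen.symm).mp hu.1
        · exact absurd hlen (hu.length_lt hX).ne
      · left
        obtain ⟨c, v, rfl⟩ := List.exists_cons_of_length_pos (hn.trans hlen)
        exact ⟨c, v, (hsplit (Nat.lt_succ_iff.mp hlen) hne).mp hu, rfl, hne⟩
  have hC : C.Finite := (hE.union hXfin).subset (hunion ▸ subset_union_right)
  have h1 : Disjoint E X := by
    rw [Set.disjoint_left]
    rintro _ ⟨c, v, hv, rfl, -⟩ hx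
    have h1 := FirstOcc.le_length hX hv.1
    have h2 := hX _ hx
    rw [List.length_cons] at h2
    omega
  have h2 : Disjoint P C := Set.disjoint_left.mpr fun u hu =>
    not_completeFirstReturn_of_firstOcc hu.1
  have h := congrArg ncard hunion
  rw [ncard_union_eq h1 hE hXfin, ncard_union_eq h2 hP hC, hcard] at h
  omega

end Returns

end LinearInvolution

/-- the set of complete first return words to `{w, w⁻¹}` has
exactly `2·Card(A)` elements. -/
theorem stmt_10 {A : Type*} [Fintype A] (L : LinearInvolution A)
    (hnc : ¬ L.HasConnection) (w : List (Letter A)) (hw : w ∈ L.lang)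
    (hne : w ≠ []) :
    (CR L.lang w).ncard = 2 * Fintype.card A := by
  have hA : Nonempty A := by
    obtain ⟨c, -⟩ := List.exists_mem_of_ne_nil w hne
    exact ⟨c.1⟩
  have hfin : L.Sig.Finite := L.Sig_finite hnc
  have hcyl := (LinearInvolution.mem_lang_iff hfin).mp hw
  have hwinv : w ≠ wordInv w := by
    obtain ⟨z, hz⟩ := hcyl
    exact (LinearInvolution.reduced_of_mem_cyl hz).ne_wordInv hne
  have hcard : (CR L.lang w).ncard =
      L.Sig.ncard + ({w, wordInv w} : Set (List (Letter A))).ncard := by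
    refine LinearInvolution.ncard_completeFirstReturnWord (n := w.length) hnc hfin ?_
      (List.length_pos_iff.mpr hne) ?_ ⟨w, Or.inl rfl⟩ ?_
    · rintro x (rfl | rfl)
      · rfl
      · exact wordInv_length w
    · rintro x (rfl | rfl)
      · exact hw
      · exact (LinearInvolution.mem_lang_iff hfin).mpr (LinearInvolution.cyl_wordInv_nonempty hcyl)
    · rintro x (rfl | rfl)
      · exact Or.inr rfl
      · exact Or.inl (wordInv_wordInv w)
  rw [hcard, ncard_pair hwinv, L.Sig_card]
  have := Fintype.card_pos (α := A)
  omega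

end LinInv
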